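/- arXiv:0812.5023 — 2 statements merged into one kernel-verified Lean document; each statement's English description precedes it below -/
import Mathlib

section
/- Let n ≥ 1 and a_1,…,a_n ∈ Z_{≥0}. Then the polynomial ∂_{w[1,n]}(X_1^{a_1}···X_n^{a_n}) is either zero or satisfies, for every k ∈ {1,…,n}, deg_{X_k}( ∂_{w[1,n]}(X_1^{a_1}···X_n^{a_n}) ) ≤ max_i(a_i) − n + 1. In particular ∂_{w[1,n]}(X_1^{a_1}···X_n^{a_n}) = 0 whenever max_i(a_i) < n − 1. -/
open scoped BigOperators

namespace Dem

/-- The polynomial ring `ℤ[X_1, …, X_n]` (0-based variables). -/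
abbrev R (n : ℕ) := MvPolynomial (Fin n) ℤ

/-- `D` is the family of Demazure (BGG) operators `∂_i` (0-based), characterized
by `(X_{i+1} - X_i) · ∂_i P = P - s_i(P)`. -/
def IsDemFamily {n : ℕ} (D : ℕ → R n → R n) : Prop :=
  ∀ (i : ℕ) (h : i + 1 < n) (P : R n),
    (MvPolynomial.X (⟨i + 1, h⟩ : Fin n) - MvPolynomial.X ⟨i, by omega⟩) * D i P
      = P - MvPolynomial.rename (Equiv.swap (⟨i, by omega⟩ : Fin n) ⟨i + 1, h⟩) P

/-- `∂_w = ∂_{i_1} ∘ ⋯ ∘ ∂_{i_r}` for a word `l = [i_1, …, i_r]` (rightmost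
applied first). -/
def applyWord {n : ℕ} (D : ℕ → R n → R n) (l : List ℕ) (P : R n) : R n :=
  l.foldr (fun i Q => D i Q) P

/-- The permutation of `Fin n` given by a word in the simple transpositions. -/
def permOfWord (n : ℕ) (l : List ℕ) : Equiv.Perm (Fin n) :=
  (l.map fun i =>
    if h : i + 1 < n then Equiv.swap (⟨i, by omega⟩ : Fin n) ⟨i + 1, h⟩ else 1).prod

/-- `l` is a reduced word for the permutation `w`. -/
def IsReducedWordFor (n : ℕ) (l : List ℕ) (w : Equiv.Perm (Fin n)) : Prop :=
  (∀ i ∈ l, i + 1 < n) ∧ permOfWord n l = w ∧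
    ∀ l' : List ℕ, (∀ i ∈ l', i + 1 < n) → permOfWord n l' = w → l.length ≤ l'.length

/-- The standard reduced word for the longest element of `S_m` (0-based). -/
def longWord (m : ℕ) : List ℕ :=
  (List.range m).foldr (fun j acc => (List.range j).reverse ++ acc) []

/-- The set of variables `X_{lo+1}, …, X_n` (0-based indices `≥ lo`). -/
def varsFrom (n lo : ℕ) : Finset (Fin n) :=
  Finset.univ.filter fun a : Fin n => lo ≤ a.val

/-- The set of variables `X_1, …, X_m` (0-based indices `< m`). -/
def varsUpto (n m : ℕ) : Finset (Fin n) :=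
  Finset.univ.filter fun a : Fin n => a.val < m

/-- Elementary symmetric polynomial of degree `m` in the variables of `s`. -/
noncomputable def eOn {n : ℕ} (s : Finset (Fin n)) (m : ℕ) : R n :=
  ∑ T ∈ s.powersetCard m, ∏ a ∈ T, MvPolynomial.X a

/-- Complete homogeneous symmetric polynomial of degree `j` in the variables of
`s`. -/
noncomputable def hOn {n : ℕ} (s : Finset (Fin n)) (j : ℕ) : R n :=
  ∑ d ∈ s.sym j, (Multiset.map MvPolynomial.X (d : Multiset (Fin n))).prod

/-- `P` is symmetric in the variables with (0-based) index `≥ lo`. -/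
def SymFrom {n : ℕ} (lo : ℕ) (P : R n) : Prop :=
  ∀ a b : Fin n, lo ≤ a.val → lo ≤ b.val →
    MvPolynomial.rename (Equiv.swap a b) P = P

/-- The monomial symmetric polynomial in the first `c` of the `n` variables,
attached to the exponent vector `w` (the sum of the distinct monomials in the
`S_c`-orbit of `X_1^{w_1} ⋯ X_c^{w_c}`). -/
noncomputable def msymBlock {n : ℕ} (c : ℕ) (w : Fin c → ℕ) : R n :=
  ∑ g ∈ Finset.image
      (fun σ : Equiv.Perm (Fin c) =>
        fun i : Fin n => if h : i.val < c then w (σ ⟨i.val, h⟩) else 0)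
      Finset.univ,
    ∏ i, MvPolynomial.X i ^ g i

end Dem

namespace Dem

open MvPolynomial

theorem rename_symmetric_smul {n : ℕ} (σ : Equiv.Perm (Fin n))
    (s : symmetricSubalgebra (Fin n) ℤ) (P : R n) : rename σ (s • P) = s • rename σ P := by
  rw [Subalgebra.smul_def, Subalgebra.smul_def, smul_eq_mul, smul_eq_mul, map_mul, s.2 σ]

section Artin

/-- The subalgebra generated by the symmetric polynomials and the variables of index `≥ i`. -/
noncomputable def symAdjoinFrom (n i : ℕ) : Subalgebra ℤ (R n) :=
  Algebra.adjoin ℤ {P | P.IsSymmetric ∨ ∃ j : Fin n, i ≤ j.val ∧ P = X j}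

theorem X_mem_symAdjoinFrom {n i : ℕ} {j : Fin n} (h : i ≤ j.val) :
    (X j : R n) ∈ symAdjoinFrom n i :=
  Algebra.subset_adjoin (Or.inr ⟨j, h, rfl⟩)

theorem symAdjoinFrom_anti {n i j : ℕ} (h : i ≤ j) : symAdjoinFrom n j ≤ symAdjoinFrom n i :=
  Algebra.adjoin_mono fun _ => Or.imp_right fun ⟨k, hk, hP⟩ => ⟨k, h.trans hk, hP⟩

theorem isSymmetric_mem_symAdjoinFrom {n : ℕ} (i : ℕ) {P : R n} (hP : P.IsSymmetric) :
    P ∈ symAdjoinFrom n i :=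
  Algebra.subset_adjoin (Or.inl hP)

theorem symAdjoinFrom_zero (n : ℕ) : symAdjoinFrom n 0 = ⊤ := by
  refine eq_top_iff.2 fun P _ => ?_
  induction P using MvPolynomial.induction_on with
  | C r => exact isSymmetric_mem_symAdjoinFrom 0 (IsSymmetric.C r)
  | add p q hp hq => exact add_mem (hp trivial) (hq trivial)
  | mul_X p j hp => exact mul_mem (hp trivial) (X_mem_symAdjoinFrom (Nat.zero_le _))

/-- The monic polynomial whose roots are the variables of index `< m`. -/
noncomputable def rootPoly (n m : ℕ) : Polynomial (R n) :=
  ∏ j ∈ varsUpto n m, (Polynomial.X - Polynomial.C (X j))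

theorem rootPoly_monic (n m : ℕ) : (rootPoly n m).Monic :=
  Polynomial.monic_prod_of_monic _ _ fun _ _ => Polynomial.monic_X_sub_C _

theorem card_varsUpto {n m : ℕ} (hm : m ≤ n) : (varsUpto n m).card = m := by
  simp [varsUpto, Fin.card_filter_val_lt, hm]

theorem natDegree_rootPoly {n m : ℕ} (hm : m ≤ n) : (rootPoly n m).natDegree = m := by
  rw [rootPoly, Polynomial.natDegree_prod_of_monic _ _ fun _ _ => Polynomial.monic_X_sub_C _]
  simp [card_varsUpto hm]

theorem rootPoly_succ {n m : ℕ} (hm : m < n) :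
    rootPoly n (m + 1) = rootPoly n m * (Polynomial.X - Polynomial.C (X ⟨m, hm⟩)) := by
  have : varsUpto n (m + 1) = insert ⟨m, hm⟩ (varsUpto n m) := by
    ext j
    simp only [varsUpto, Finset.mem_filter, Finset.mem_univ, true_and, Finset.mem_insert, Fin.ext_iff]
    omega
  rw [rootPoly, this, Finset.prod_insert (by simp [varsUpto]), mul_comm]
  rfl

theorem coeff_rootPoly_mem {n m : ℕ} (hm : m ≤ n) :
    ∀ k, (rootPoly n m).coeff k ∈ symAdjoinFrom n m := by
  induction hm using Nat.decreasingInduction with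
  | self =>
    refine fun k => isSymmetric_mem_symAdjoinFrom n fun σ => ?_
    have hmap : (rootPoly n n).map (rename σ : R n →ₐ[ℤ] R n).toRingHom = rootPoly n n := by
      have hu : varsUpto n n = Finset.univ := by ext j; simp [varsUpto]
      simp only [rootPoly, hu, Polynomial.map_prod, Polynomial.map_sub, Polynomial.map_X,
        Polynomial.map_C, AlgHom.toRingHom_eq_coe, RingHom.coe_coe, rename_X]
      exact Equiv.prod_comp σ fun j => Polynomial.X - Polynomial.C (X j : R n)
    conv_rhs => rw [← hmap, Polynomial.coeff_map]
    rfl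
  | of_succ m hm ih =>
    have hm' : m < n := hm
    have key : ∀ d k, m < k + d → (rootPoly n m).coeff k ∈ symAdjoinFrom n m := by
      intro d
      induction d with
      | zero =>
        intro k hk
        rw [Polynomial.coeff_eq_zero_of_natDegree_lt (by rw [natDegree_rootPoly hm'.le]; omega)]
        exact zero_mem _
      | succ d ihd =>
        intro k hk
        have h := congrArg (fun p => p.coeff (k + 1)) (rootPoly_succ hm')
        simp only [mul_sub, Polynomial.coeff_sub, Polynomial.coeff_mul_X,
          Polynomial.coeff_mul_C] at h
        rw [eq_sub_iff_add_eq] at h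
        rw [← h]
        exact add_mem (symAdjoinFrom_anti (Nat.le_succ m) (ih (k + 1)))
          (mul_mem (ihd _ (by omega)) (X_mem_symAdjoinFrom le_rfl))
    exact fun k => key (m + 1) k (by omega)

theorem exists_monic_aeval_X_eq_zero {n i : ℕ} (hi : i < n) :
    ∃ q : Polynomial (symAdjoinFrom n (i + 1)), q.Monic ∧ q.natDegree = i + 1 ∧
      Polynomial.aeval (X ⟨i, hi⟩ : R n) q = 0 := by
  obtain ⟨q, hq, hdeg, hmonic⟩ := Polynomial.lifts_and_natDegree_eq_and_monic
    (f := algebraMap (symAdjoinFrom n (i + 1)) (R n)) (p := rootPoly n (i + 1))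
    ((Polynomial.lifts_iff_coeff_lifts _).2 fun k => ⟨⟨_, coeff_rootPoly_mem hi k⟩, rfl⟩)
    (rootPoly_monic _ _)
  refine ⟨q, hmonic, hdeg.trans (natDegree_rootPoly hi), ?_⟩
  rw [Polynomial.aeval_def, ← Polynomial.eval_map, hq, rootPoly_succ hi]
  simp

theorem mem_adjoin_X_of_mem_symAdjoinFrom {n i : ℕ} (hi : i < n) {f : R n}
    (hf : f ∈ symAdjoinFrom n i) :
    f ∈ Algebra.adjoin (symAdjoinFrom n (i + 1)) {(X ⟨i, hi⟩ : R n)} := by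
  induction hf using Algebra.adjoin_induction with
  | mem P hP =>
    obtain hP | ⟨j, hj, rfl⟩ := hP
    · exact Subalgebra.algebraMap_mem _
        (⟨P, isSymmetric_mem_symAdjoinFrom (i + 1) hP⟩ : symAdjoinFrom n (i + 1))
    rcases hj.eq_or_lt with rfl | hj
    · exact Algebra.subset_adjoin rfl
    · exact Subalgebra.algebraMap_mem _ (⟨X j, X_mem_symAdjoinFrom hj⟩ : symAdjoinFrom n (i + 1))
  | algebraMap r =>
    exact Subalgebra.algebraMap_mem _ (algebraMap ℤ (symAdjoinFrom n (i + 1)) r)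
  | add p q _ _ hp hq => exact add_mem hp hq
  | mul p q _ _ hp hq => exact mul_mem hp hq

theorem mem_span_pow_of_mem_adjoin {A B : Type*} [CommRing A] [CommRing B] [Algebra A B] {x f : B}
    {d : ℕ} (h : ∃ q : Polynomial A, q.Monic ∧ q.natDegree = d ∧ Polynomial.aeval x q = 0)
    (hf : f ∈ Algebra.adjoin A {x}) :
    f ∈ Submodule.span A ((x ^ ·) '' (Finset.range d : Set ℕ)) := by
  classical
  obtain ⟨q, hmonic, rfl, hroot⟩ := h
  rw [← Finset.coe_image, Submodule.span_range_natDegree_eq_adjoin hmonic hroot]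
  exact hf

theorem mem_span_pow_of_mem_symAdjoinFrom {n i : ℕ} (hi : i < n) {f : R n}
    (hf : f ∈ symAdjoinFrom n i) :
    f ∈ Submodule.span (symAdjoinFrom n (i + 1))
      (((X ⟨i, hi⟩ : R n) ^ ·) '' (Finset.range (i + 1) : Set ℕ)) :=
  mem_span_pow_of_mem_adjoin (exists_monic_aeval_X_eq_zero hi)
    (mem_adjoin_X_of_mem_symAdjoinFrom hi hf)

theorem prod_pow_mul_mem {n i : ℕ} (hi : i ≤ n)
    (E : Submodule (symmetricSubalgebra (Fin n) ℤ) (R n))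
    (hE : ∀ b : Fin n → ℕ, (∀ j, b j ≤ j.val) → ∏ j, X j ^ b j ∈ E) :
    ∀ b : Fin n → ℕ, (∀ j, b j ≤ j.val) → (∀ j, i ≤ j.val → b j = 0) →
      ∀ f ∈ symAdjoinFrom n i, (∏ j, X j ^ b j) * f ∈ E := by
  induction hi using Nat.decreasingInduction with
  | self =>
    intro b hb _ f hf
    have hle : symAdjoinFrom n n ≤ symmetricSubalgebra (Fin n) ℤ := by
      refine Algebra.adjoin_le fun P hP => ?_
      rcases hP with hP | ⟨j, hj, -⟩
      · exact hP
      · omega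
    rw [mul_comm]
    exact E.smul_mem ⟨f, hle hf⟩ (hE b hb)
  | of_succ i hi ih =>
    intro b hb hb0 f hf
    suffices h : ∀ g ∈ symAdjoinFrom n (i + 1), (∏ j, X j ^ b j) * (g * f) ∈ E by
      simpa using h 1 (one_mem _)
    replace hf := mem_span_pow_of_mem_symAdjoinFrom hi hf
    induction hf using Submodule.span_induction with
    | mem P hP =>
      intro g hg
      obtain ⟨t, ht, rfl⟩ := hP
      have hprod : ∏ j, (X j : R n) ^ Function.update b ⟨i, hi⟩ t j =
          (∏ j, X j ^ b j) * X ⟨i, hi⟩ ^ t := by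
        rw [← Finset.mul_prod_erase _ _ (Finset.mem_univ (⟨i, hi⟩ : Fin n)),
          ← Finset.mul_prod_erase _ (fun j => X j ^ b j) (Finset.mem_univ (⟨i, hi⟩ : Fin n)),
          hb0 ⟨i, hi⟩ le_rfl, Function.update_self, pow_zero, one_mul, mul_comm]
        congr 1
        refine Finset.prod_congr rfl fun j hj => ?_
        rw [Function.update_of_ne (Finset.ne_of_mem_erase hj)]
      have := ih (Function.update b ⟨i, hi⟩ t) (fun j => ?_) (fun j hj => ?_) g hg
      · rw [hprod] at this
        convert this using 1
        ring
      · rcases eq_or_ne j ⟨i, hi⟩ with rfl | hj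
        · rw [Function.update_self]
          exact Nat.lt_succ_iff.1 (Finset.mem_range.1 (Finset.mem_coe.1 ht))
        · rw [Function.update_of_ne hj]
          exact hb j
      · rw [Function.update_of_ne (by rintro rfl; simp at hj)]
        exact hb0 j (by omega)
    | zero => simp
    | add p q _ _ hp hq =>
      intro g hg
      rw [mul_add, mul_add]
      exact E.add_mem (hp g hg) (hq g hg)
    | smul r p _ hp =>
      intro g hg
      have := hp (g * (r : R n)) (mul_mem hg r.2)
      rwa [mul_assoc] at this

/-- The polynomial ring is spanned over the symmetric polynomials by Artin's monomials. -/
theorem span_artin_eq_top (n : ℕ) :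
    Submodule.span (symmetricSubalgebra (Fin n) ℤ)
      {P : R n | ∃ b : Fin n → ℕ, (∀ j, b j ≤ j.val) ∧ P = ∏ j, X j ^ b j} = ⊤ := by
  refine eq_top_iff.2 fun P _ => ?_
  have h := prod_pow_mul_mem (Nat.zero_le n) (Submodule.span (symmetricSubalgebra (Fin n) ℤ)
      {P : R n | ∃ b : Fin n → ℕ, (∀ j, b j ≤ j.val) ∧ P = ∏ j, X j ^ b j})
    (fun b hb => Submodule.subset_span ⟨b, hb, rfl⟩) 0 (by simp) (by simp) P
    (by rw [symAdjoinFrom_zero]; exact Algebra.mem_top)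
  simpa only [Pi.zero_apply, pow_zero, Finset.prod_const_one, one_mul] using h

end Artin

section Demazure

variable {n : ℕ} {D : ℕ → R n → R n}

theorem X_sub_X_ne_zero {i j : Fin n} (h : i ≠ j) : (X i - X j : R n) ≠ 0 :=
  sub_ne_zero.2 fun e => h (X_injective e)

theorem IsDemFamily.isLinearMap (hD : IsDemFamily D) {i : ℕ} (hi : i + 1 < n) :
    IsLinearMap (symmetricSubalgebra (Fin n) ℤ) (D i) := by
  have hne : (X ⟨i + 1, hi⟩ - X ⟨i, by omega⟩ : R n) ≠ 0 := X_sub_X_ne_zero (by simp)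
  constructor
  · intro P Q
    apply mul_left_cancel₀ hne
    rw [mul_add, hD i hi, hD i hi, hD i hi, map_add]
    ring
  · intro s P
    apply mul_left_cancel₀ hne
    rw [mul_smul_comm, hD i hi, hD i hi, rename_symmetric_smul, smul_sub]

theorem IsDemFamily.applyWord_isLinearMap (hD : IsDemFamily D) {l : List ℕ}
    (hl : ∀ i ∈ l, i + 1 < n) :
    IsLinearMap (symmetricSubalgebra (Fin n) ℤ) (applyWord D l) := by
  induction l with
  | nil => exact ⟨fun _ _ => rfl, fun _ _ => rfl⟩
  | cons i l ih =>
    rw [List.forall_mem_cons] at hl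
    have h := ih hl.2
    have hi := hD.isLinearMap hl.1
    exact ⟨fun P Q => (congrArg (D i) (h.1 P Q)).trans (hi.1 _ _),
      fun s P => (congrArg (D i) (h.2 s P)).trans (hi.2 _ _)⟩

theorem IsDemFamily.totalDegree_add_one_le (hD : IsDemFamily D) {i : ℕ} (hi : i + 1 < n) {P : R n}
    (hP : D i P ≠ 0) : (D i P).totalDegree + 1 ≤ P.totalDegree := by
  have hne : (X ⟨i + 1, hi⟩ - X ⟨i, by omega⟩ : R n) ≠ 0 := X_sub_X_ne_zero (by simp)
  have hdeg : (X ⟨i + 1, hi⟩ - X ⟨i, by omega⟩ : R n).totalDegree = 1 :=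
    ((isHomogeneous_X ℤ _).sub (isHomogeneous_X ℤ _)).totalDegree hne
  have h := totalDegree_mul_of_isDomain hne hP
  rw [hD i hi, hdeg] at h
  rw [add_comm, ← h]
  exact (totalDegree_sub _ _).trans (max_le le_rfl (totalDegree_rename_le _ _))

theorem IsDemFamily.applyWord_eq_zero_or_totalDegree_le (hD : IsDemFamily D) {l : List ℕ}
    (hl : ∀ i ∈ l, i + 1 < n) (P : R n) :
    applyWord D l P = 0 ∨ (applyWord D l P).totalDegree + l.length ≤ P.totalDegree := by
  induction l with
  | nil => exact Or.inr le_rfl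
  | cons i l ih =>
    rw [List.forall_mem_cons] at hl
    refine or_iff_not_imp_left.2 fun hne => ?_
    change D i (applyWord D l P) ≠ 0 at hne
    have h1 := hD.totalDegree_add_one_le hl.1 hne
    rcases ih hl.2 with h | h
    · exact absurd (h ▸ (hD.isLinearMap hl.1).map_zero) hne
    · change (D i (applyWord D l P)).totalDegree + (l.length + 1) ≤ _
      omega

end Demazure

section Alternant

variable {n : ℕ}

/-- The antisymmetrization map, linear over the symmetric polynomials. -/
noncomputable def antisymm (n : ℕ) : R n →ₗ[symmetricSubalgebra (Fin n) ℤ] R n where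
  toFun P := ∑ σ : Equiv.Perm (Fin n), Equiv.Perm.sign σ • rename σ P
  map_add' P Q := by simp [smul_add, Finset.sum_add_distrib]
  map_smul' s P := by
    rw [RingHom.id_apply, Finset.smul_sum]
    refine Finset.sum_congr rfl fun σ _ => ?_
    rw [rename_symmetric_smul, smul_comm]

theorem antisymm_monomial (b : Fin n → ℕ) :
    antisymm n (∏ j, X j ^ b j) = Matrix.det (Matrix.of fun i j => (X i : R n) ^ b j) := by
  simp [antisymm, Matrix.det_apply, map_prod]

theorem antisymm_monomial_eq_zero {b : Fin n → ℕ} (hb : ¬ Function.Injective b) :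
    antisymm n (∏ j, X j ^ b j) = 0 := by
  rw [antisymm_monomial]
  simp only [Function.Injective, not_forall] at hb
  obtain ⟨i, j, hij, hne⟩ := hb
  exact Matrix.det_zero_of_column_eq hne fun k => by simp [hij]

theorem eq_val_of_injective_of_le {b : Fin n → ℕ} (hb : ∀ j, b j ≤ j.val)
    (hinj : Function.Injective b) : b = Fin.val := by
  suffices h : ∀ m, ∀ j : Fin n, j.val = m → b j = j.val from funext fun j => h _ j rfl
  intro m
  induction m using Nat.strong_induction_on with
  | _ m ih =>
    rintro j rfl
    by_contra hne
    have hlt : b j < j.val := lt_of_le_of_ne (hb j) hne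
    have := hinj (ih (b j) hlt ⟨b j, hlt.trans j.isLt⟩ rfl)
    exact hne (congrArg Fin.val this)

/-- The Vandermonde determinant in the variables. -/
noncomputable def vand (n : ℕ) : R n := Matrix.det (Matrix.vandermonde X)

theorem antisymm_staircase : antisymm n (∏ j, X j ^ j.val) = vand n :=
  antisymm_monomial _

theorem vand_ne_zero : vand n ≠ 0 :=
  Matrix.det_vandermonde_ne_zero_iff.2 X_injective

theorem degreeOf_antisymm_monomial_le (a : Fin n → ℕ) (k : Fin n) :
    degreeOf k (antisymm n (∏ j, X j ^ a j)) ≤ Finset.univ.sup a := by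
  refine (degreeOf_sum_le _ _ _).trans (Finset.sup_le fun σ _ => ?_)
  have h : degreeOf k (rename σ (∏ j, (X j : R n) ^ a j)) ≤ Finset.univ.sup a := by
    obtain ⟨j, rfl⟩ := σ.surjective k
    rw [degreeOf_rename_of_injective σ.injective]
    refine (degreeOf_prod_le _ _ _).trans ?_
    rw [Finset.sum_eq_single j (fun i _ hi => degreeOf_X_pow_of_ne _ hi.symm) (by simp),
      degreeOf_X_self_pow]
    exact Finset.le_sup (Finset.mem_univ j)
  rcases Int.units_eq_one_or (Equiv.Perm.sign σ) with hs | hs <;> simpa [hs] using h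

theorem le_degreeOf_vand (k : Fin n) : n ≤ degreeOf k (vand n) + 1 := by
  have hne : ∀ i : Fin n, ∀ j ∈ Finset.Ioi i, (X j - X i : R n) ≠ 0 := fun i j hj =>
    X_sub_X_ne_zero (Finset.mem_Ioi.1 hj).ne'
  rw [vand, Matrix.det_vandermonde,
    degreeOf_prod_eq _ _ fun i _ => Finset.prod_ne_zero_iff.2 (hne i)]
  have hone : ∀ i j : Fin n, i ≠ j → k = i ∨ k = j → 1 ≤ degreeOf k (X j - X i : R n) := by
    intro i j hij hk
    have hmem : Finsupp.single k 1 ∈ (X j - X i : R n).support := by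
      rw [mem_support_iff, coeff_sub, coeff_X, coeff_X]
      rcases hk with rfl | rfl
      · simp [Finsupp.single_left_inj, hij.symm]
      · simp [Finsupp.single_left_inj, hij]
    simpa using le_degreeOf_of_mem_support k hmem
  have hsum : ∀ i : Fin n, (if i = k then n - 1 - k.val else if i < k then 1 else 0) ≤
      degreeOf k (∏ j ∈ Finset.Ioi i, (X j - X i : R n)) := by
    intro i
    rw [degreeOf_prod_eq _ _ (hne i)]
    split_ifs with h1 h2
    · subst h1
      rw [← Fin.card_Ioi, Finset.card_eq_sum_ones]
      exact Finset.sum_le_sum fun j hj => hone _ _ (Finset.mem_Ioi.1 hj).ne (Or.inl rfl)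
    · exact (hone i k h2.ne (Or.inr rfl)).trans
        (Finset.single_le_sum (f := fun j => degreeOf k (X j - X i : R n))
          (fun _ _ => Nat.zero_le _) (Finset.mem_Ioi.2 h2))
    · exact Nat.zero_le _
  have htot : ∑ i : Fin n, (if i = k then n - 1 - k.val else if i < k then 1 else 0) =
      (n - 1 - k.val) + k.val := by
    have hsplit : ∀ i : Fin n, (if i = k then n - 1 - k.val else if i < k then 1 else 0) =
        (if i = k then n - 1 - k.val else 0) + if i < k then 1 else 0 := by
      intro i
      split_ifs with h1 h2 <;> simp_all
    simp [hsplit, Finset.sum_add_distrib, Finset.filter_gt_eq_Iio]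
  have := Finset.sum_le_sum fun i (_ : i ∈ Finset.univ) => hsum i
  omega

end Alternant

section Length

/-- The set of inversions of a permutation. -/
def inversions {n : ℕ} (σ : Equiv.Perm (Fin n)) : Finset (Fin n × Fin n) :=
  Finset.univ.filter fun p => p.1 < p.2 ∧ σ p.2 < σ p.1

theorem card_inversions_swap_mul_le {n i : ℕ} (hi : i + 1 < n) (σ : Equiv.Perm (Fin n)) :
    (inversions (Equiv.swap (⟨i, by omega⟩ : Fin n) ⟨i + 1, hi⟩ * σ)).card ≤
      (inversions σ).card + 1 := by
  refine (Finset.card_le_card (t := insert (σ.symm ⟨i, by omega⟩, σ.symm ⟨i + 1, hi⟩)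
    (inversions σ)) fun p hp => ?_).trans (Finset.card_insert_le _ _)
  rw [inversions, Finset.mem_filter_univ] at hp
  rw [Finset.mem_insert, inversions, Finset.mem_filter_univ, Prod.ext_iff, Equiv.eq_symm_apply,
    Equiv.eq_symm_apply]
  have hne : σ p.1 ≠ σ p.2 := σ.injective.ne hp.1.ne
  obtain ⟨h1, h2⟩ := hp
  rw [Equiv.Perm.mul_apply, Equiv.Perm.mul_apply, Equiv.swap_apply_def, Equiv.swap_apply_def] at h2
  simp only [Fin.lt_def, Fin.ext_iff, ne_eq] at h1 h2 hne ⊢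
  split_ifs at h2 <;> (try simp only at h2) <;> omega

theorem card_inversions_permOfWord_le {n : ℕ} {l : List ℕ} (hl : ∀ i ∈ l, i + 1 < n) :
    (inversions (permOfWord n l)).card ≤ l.length := by
  induction l with
  | nil =>
    rw [show permOfWord n [] = 1 from rfl]
    simp only [inversions, List.length_nil, Nat.le_zero, Finset.card_eq_zero]
    exact Finset.filter_eq_empty_iff.2 fun p _ h => h.1.asymm h.2
  | cons i l ih =>
    rw [List.forall_mem_cons] at hl
    have : permOfWord n (i :: l) =
        Equiv.swap (⟨i, by omega⟩ : Fin n) ⟨i + 1, hl.1⟩ * permOfWord n l := by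
      simp [permOfWord, hl.1]
    rw [this]
    exact (card_inversions_swap_mul_le hl.1 _).trans (Nat.succ_le_succ (ih hl.2))

theorem card_inversions_revPerm (n : ℕ) :
    (inversions (Fin.revPerm : Equiv.Perm (Fin n))).card = ∑ j : Fin n, j.val := by
  simp only [inversions, Fin.revPerm_apply, Fin.rev_lt_rev, and_self]
  rw [Finset.card_filter, Fintype.sum_prod_type_right]
  refine Finset.sum_congr rfl fun j _ => ?_
  rw [← Finset.card_filter, Finset.filter_gt_eq_Iio, Fin.card_Iio]

end Length

/-- Up to an integer factor, `∂_{w₀}` is the quotient of the antisymmetrization by the Vandermonde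
determinant. -/
theorem exists_vand_mul_applyWord {n : ℕ} {D : ℕ → R n → R n} (hD : IsDemFamily D) {l : List ℕ}
    (hl : ∀ i ∈ l, i + 1 < n) (hlen : ∑ j : Fin n, j.val ≤ l.length) :
    ∃ c : ℤ, ∀ P, vand n * applyWord D l P = C c * antisymm n P := by
  have hdeg : ∀ b : Fin n → ℕ, (∏ j, (X j : R n) ^ b j).totalDegree = ∑ j, b j := fun b =>
    (IsHomogeneous.prod _ _ _ fun j _ => isHomogeneous_X_pow j (b j)).totalDegree
      (Finset.prod_ne_zero_iff.2 fun j _ => pow_ne_zero _ (X_ne_zero j))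
  have hlow := fun b => hdeg b ▸ hD.applyWord_eq_zero_or_totalDegree_le hl (∏ j, X j ^ b j)
  obtain ⟨c, hc⟩ : ∃ c : ℤ, applyWord D l (∏ j, X j ^ j.val) = C c := by
    rcases hlow Fin.val with h | h
    · exact ⟨0, by simpa using h⟩
    · exact ⟨_, totalDegree_eq_zero_iff_eq_C.1 (by omega)⟩
  refine ⟨c, fun P => ?_⟩
  have heq : LinearMap.mulLeft (symmetricSubalgebra (Fin n) ℤ) (vand n) ∘ₗ
      (hD.applyWord_isLinearMap hl).mk' _ =
      LinearMap.mulLeft (symmetricSubalgebra (Fin n) ℤ) (C c : R n) ∘ₗ antisymm n := by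
    refine LinearMap.ext_on (span_artin_eq_top n) ?_
    rintro _ ⟨b, hb, rfl⟩
    simp only [LinearMap.comp_apply, LinearMap.mulLeft_apply, IsLinearMap.mk'_apply]
    by_cases hinj : Function.Injective b
    · obtain rfl := eq_val_of_injective_of_le hb hinj
      rw [hc, antisymm_staircase, mul_comm]
    · rw [antisymm_monomial_eq_zero hinj, mul_zero]
      obtain ⟨j, hj⟩ : ∃ j, b j < j.val := by
        by_contra! h
        exact hinj (funext (fun j => (hb j).antisymm (h j)) ▸ Fin.val_injective)
      have := Finset.sum_lt_sum (fun j _ => hb j) ⟨j, Finset.mem_univ j, hj⟩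
      rcases hlow b with h | h
      · rw [h, mul_zero]
      · omega
  exact LinearMap.congr_fun heq P

end Dem


open Dem in
/-- `∂_{w₀}(X_1^{a_1} ⋯ X_n^{a_n})` is zero or has degree at
most `max_i(a_i) - n + 1` in every variable; in particular it vanishes when
`max_i(a_i) < n - 1`. -/
theorem statement10 (n : ℕ) (hn : 1 ≤ n)
    (D : ℕ → R n → R n) (hD : IsDemFamily D)
    (l : List ℕ) (hl : IsReducedWordFor n l Fin.revPerm)
    (a : Fin n → ℕ) :
    (applyWord D l (∏ b : Fin n, MvPolynomial.X b ^ a b) = 0 ∨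
      ∀ idx : Fin n,
        (MvPolynomial.degreeOf idx
            (applyWord D l (∏ b : Fin n, MvPolynomial.X b ^ a b)) : ℤ)
          ≤ ((Finset.univ.sup a : ℕ) : ℤ) - n + 1) ∧
    (((Finset.univ.sup a : ℕ) : ℤ) < (n : ℤ) - 1 →
      applyWord D l (∏ b : Fin n, MvPolynomial.X b ^ a b) = 0) := by
  have hlen : ∑ j : Fin n, j.val ≤ l.length := by
    rw [← card_inversions_revPerm, ← hl.2.1]
    exact card_inversions_permOfWord_le hl.1
  obtain ⟨c, hc⟩ := exists_vand_mul_applyWord hD hl.1 hlen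
  have hbound : ∀ idx : Fin n, applyWord D l (∏ b : Fin n, MvPolynomial.X b ^ a b) ≠ 0 →
      MvPolynomial.degreeOf idx (applyWord D l (∏ b : Fin n, MvPolynomial.X b ^ a b)) + n ≤
        Finset.univ.sup a + 1 := by
    intro idx hne
    have h := MvPolynomial.degreeOf_mul_eq (n := idx) vand_ne_zero hne
    rw [hc] at h
    have h1 := (MvPolynomial.degreeOf_C_mul_le _ idx c).trans (degreeOf_antisymm_monomial_le a idx)
    have h2 := le_degreeOf_vand idx
    omega
  refine ⟨or_iff_not_imp_left.2 fun hne idx => ?_, fun hlt => ?_⟩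
  · have := hbound idx hne
    omega
  · by_contra hne
    have := hbound ⟨0, hn⟩ hne
    omega
end

section
/- Let n ≥ 1 and let i be an integer with 0 ≤ i and 2i < n. Set D = ∂_w for w = s_{n−1}s_{n−2}···s_{i+1} (an element of S_n; D is the identity if i = n−1). Then: (1) D( X_{i+1}^j · ∏_{r=1}^{i} (X_r − X_{i+1}) ) = 0 for every integer j with 0 ≤ j < n − 2i − 1; (2) D( X_{i+1}^{n−2i−1} · ∏_{r=1}^{i} (X_r − X_{i+1}) ) = (−1)^{n+1}. -/
open scoped BigOperators

namespace Dem

/-- The complete homogeneous symmetric polynomial of degree `d` evaluated at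
`x 0, …, x (k - 1)`. -/
def completeHomog {A : Type*} [CommRing A] (x : ℕ → A) : ℕ → ℕ → A
  | _, 0 => 1
  | 0, _ + 1 => 0
  | k + 1, d + 1 => completeHomog x k (d + 1) + x k * completeHomog x (k + 1) d

lemma completeHomog_zero {A : Type*} [CommRing A] (x : ℕ → A) (k : ℕ) :
    completeHomog x k 0 = 1 := by
  cases k <;> simp [completeHomog]

lemma completeHomog_one {A : Type*} [CommRing A] (x : ℕ → A) (d : ℕ) :
    completeHomog x 1 d = x 0 ^ d := by
  induction d with
  | zero => simp [completeHomog]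
  | succ d ih => simp [completeHomog, ih, pow_succ']

lemma map_completeHomog {A : Type*} [CommRing A] (x : ℕ → A) (f : A →+* A) (k : ℕ)
    (hf : ∀ t < k, f (x t) = x t) (d : ℕ) :
    f (completeHomog x k d) = completeHomog x k d := by
  induction k generalizing d with
  | zero => cases d <;> simp [completeHomog]
  | succ k ih =>
    induction d with
    | zero => simp [completeHomog]
    | succ d ihd =>
      simp only [completeHomog, map_add, map_mul, ihd, hf k (Nat.lt_succ_self k),
        ih (fun t ht => hf t (Nat.lt_succ_of_lt ht))]

/-- If `f` sends `x k` to `x (k + 1)` and fixes the earlier `x t`, then the divided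
difference of `h_{d+1}(x 0, …, x k)` is `-h_d(x 0, …, x (k + 1))`. -/
lemma completeHomog_sub_map {A : Type*} [CommRing A] (x : ℕ → A) (f : A →+* A) (k : ℕ)
    (hf : ∀ t < k, f (x t) = x t) (hk : f (x k) = x (k + 1)) (d : ℕ) :
    completeHomog x (k + 1) (d + 1) - f (completeHomog x (k + 1) (d + 1)) =
      (x (k + 1) - x k) * -completeHomog x (k + 2) d := by
  induction d with
  | zero =>
    simp only [completeHomog, map_add, map_mul, map_one, hk, map_completeHomog x f k hf]
    ring
  | succ d ih =>
    rw [completeHomog.eq_3 x k (d + 1), completeHomog.eq_3 x (k + 1) d, map_add, map_mul, hk,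
      map_completeHomog x f k hf]
    linear_combination x (k + 1) * ih

variable {n : ℕ} {D : ℕ → R n → R n}

lemma IsDemFamily.eq_of_mul_eq (hD : IsDemFamily D) {i : ℕ} (h : i + 1 < n) {P Q : R n}
    (hQ : P - MvPolynomial.rename (Equiv.swap (⟨i, by omega⟩ : Fin n) ⟨i + 1, h⟩) P =
      (MvPolynomial.X (⟨i + 1, h⟩ : Fin n) - MvPolynomial.X ⟨i, by omega⟩) * Q) :
    D i P = Q := by
  have hne : (MvPolynomial.X (⟨i + 1, h⟩ : Fin n) - MvPolynomial.X ⟨i, by omega⟩ : R n) ≠ 0 := by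
    rw [sub_ne_zero]
    intro e
    have := MvPolynomial.X_injective e
    simp at this
  exact mul_left_cancel₀ hne ((hD i h P).trans hQ)

lemma IsDemFamily.map_sub (hD : IsDemFamily D) {i : ℕ} (h : i + 1 < n) (P Q : R n) :
    D i (P - Q) = D i P - D i Q := by
  refine hD.eq_of_mul_eq h ?_
  rw [mul_sub, hD i h, hD i h, _root_.map_sub]
  ring

lemma IsDemFamily.map_mul (hD : IsDemFamily D) {i : ℕ} (h : i + 1 < n) (c P : R n)
    (hc : MvPolynomial.rename (Equiv.swap (⟨i, by omega⟩ : Fin n) ⟨i + 1, h⟩) c = c) :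
    D i (c * P) = c * D i P := by
  refine hD.eq_of_mul_eq h ?_
  rw [mul_left_comm, hD i h, _root_.map_mul, hc]
  ring

lemma IsDemFamily.map_C (hD : IsDemFamily D) {i : ℕ} (h : i + 1 < n) (c : ℤ) :
    D i (MvPolynomial.C c) = 0 :=
  hD.eq_of_mul_eq h (by simp)

/-- The word of `s_{i+m} ⋯ s_{i+1}`, with letters numbered from `0`. -/
abbrev descWord (i m : ℕ) : List ℕ := (List.range m).reverse.map (· + i)

lemma applyWord_descWord_succ (i m : ℕ) (P : R n) :
    applyWord D (descWord i (m + 1)) P = D (m + i) (applyWord D (descWord i m) P) := by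
  simp [applyWord, descWord, List.range_succ]

lemma IsDemFamily.applyWord_sub (hD : IsDemFamily D) (i m : ℕ) (h : i + m < n) (P Q : R n) :
    applyWord D (descWord i m) (P - Q) =
      applyWord D (descWord i m) P - applyWord D (descWord i m) Q := by
  induction m with
  | zero => simp [applyWord]
  | succ m ih =>
    simp only [applyWord_descWord_succ]
    rw [ih (by omega), hD.map_sub (by omega)]

lemma IsDemFamily.applyWord_X_mul (hD : IsDemFamily D) (i m : ℕ) (h : i + m < n)
    (r : Fin n) (hr : r.val < i) (P : R n) :
    applyWord D (descWord i m) (MvPolynomial.X r * P) =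
      MvPolynomial.X r * applyWord D (descWord i m) P := by
  induction m with
  | zero => simp [applyWord]
  | succ m ih =>
    simp only [applyWord_descWord_succ]
    rw [ih (by omega), hD.map_mul (by omega)]
    rw [MvPolynomial.rename_X, Equiv.swap_apply_of_ne_of_ne] <;>
      · rw [Ne, Fin.ext_iff]
        dsimp only
        omega

/-- The variables of `R n` from index `i` on, continued by `0`. -/
noncomputable def varSeq (n i : ℕ) (t : ℕ) : R n :=
  if h : t + i < n then MvPolynomial.X ⟨t + i, h⟩ else 0

lemma IsDemFamily.map_completeHomog (hD : IsDemFamily D) (i k d : ℕ) (h : k + i + 1 < n) :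
    D (k + i) (completeHomog (varSeq n i) (k + 1) (d + 1)) =
      -completeHomog (varSeq n i) (k + 2) d := by
  refine hD.eq_of_mul_eq h ?_
  have e0 : varSeq n i k = MvPolynomial.X ⟨k + i, by omega⟩ := dif_pos (by omega)
  have e1 : varSeq n i (k + 1) = MvPolynomial.X ⟨k + i + 1, h⟩ := by
    rw [varSeq, dif_pos (by omega)]
    congr 2
    omega
  rw [← e0, ← e1]
  refine completeHomog_sub_map (varSeq n i) (MvPolynomial.rename _ : R n →ₐ[ℤ] R n).toRingHom
    k ?_ ?_ d
  · intro t ht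
    rw [varSeq, dif_pos (by omega)]
    simp only [AlgHom.toRingHom_eq_coe, RingHom.coe_coe]
    rw [MvPolynomial.rename_X, Equiv.swap_apply_of_ne_of_ne] <;>
      · rw [Ne, Fin.ext_iff]
        dsimp only
        omega
  · rw [e0, e1]
    simp

lemma IsDemFamily.applyWord_X_pow_add (hD : IsDemFamily D) (i m d : ℕ) (h : i + m < n) :
    applyWord D (descWord i m) (MvPolynomial.X (⟨i, by omega⟩ : Fin n) ^ (d + m)) =
      MvPolynomial.C ((-1) ^ m) * completeHomog (varSeq n i) (m + 1) d := by
  induction m generalizing d with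
  | zero =>
    rw [completeHomog_one, varSeq, dif_pos (by omega)]
    simp [applyWord]
  | succ m ih =>
    rw [applyWord_descWord_succ, ← add_assoc, add_right_comm, ih (d + 1) (by omega),
      hD.map_mul (by omega) _ _ (MvPolynomial.rename_C _ _),
      hD.map_completeHomog i m d (by omega), pow_succ]
    simp

lemma IsDemFamily.applyWord_X_pow_self (hD : IsDemFamily D) (i m : ℕ) (h : i + m < n) :
    applyWord D (descWord i m) (MvPolynomial.X (⟨i, by omega⟩ : Fin n) ^ m) =
      MvPolynomial.C ((-1) ^ m) := by
  have := hD.applyWord_X_pow_add i m 0 h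
  rwa [zero_add, completeHomog_zero, mul_one] at this

lemma IsDemFamily.applyWord_X_pow_of_lt (hD : IsDemFamily D) (i m d : ℕ) (h : i + m < n)
    (hd : d < m) :
    applyWord D (descWord i m) (MvPolynomial.X (⟨i, by omega⟩ : Fin n) ^ d) = 0 := by
  induction m, Nat.succ_le_of_lt hd using Nat.le_induction with
  | base =>
    rw [applyWord_descWord_succ, hD.applyWord_X_pow_self i d (by omega), hD.map_C (by omega)]
  | succ m hm ih =>
    rw [applyWord_descWord_succ, ih (by omega) (by omega)]
    simpa using hD.map_C (i := m + i) (by omega) 0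

lemma IsDemFamily.applyWord_X_pow_mul_prod (hD : IsDemFamily D) (i m : ℕ) (h : i + m < n)
    (s : Finset (Fin i)) (j : ℕ) (hj : j + s.card ≤ m) :
    applyWord D (descWord i m)
        (MvPolynomial.X (⟨i, by omega⟩ : Fin n) ^ j *
          ∏ r ∈ s, (MvPolynomial.X (Fin.castLE (by omega) r) -
            MvPolynomial.X (⟨i, by omega⟩ : Fin n))) =
      if j + s.card = m then MvPolynomial.C ((-1) ^ (m + s.card)) else 0 := by
  induction s using Finset.induction_on generalizing j with
  | empty =>
    simp only [Finset.prod_empty, mul_one, Finset.card_empty, add_zero] at hj ⊢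
    split_ifs with e
    · subst e
      exact hD.applyWord_X_pow_self i j h
    · exact hD.applyWord_X_pow_of_lt i m j h (by omega)
  | insert r s hr ih =>
    rw [Finset.card_insert_of_notMem hr] at hj ⊢
    rw [Finset.prod_insert hr, mul_left_comm, sub_mul,
      ← mul_assoc (MvPolynomial.X (⟨i, by omega⟩ : Fin n) : R n),
      ← pow_succ', hD.applyWord_sub i m h, hD.applyWord_X_mul i m h _ r.isLt,
      ih j (by omega), ih (j + 1) (by omega), if_neg (by omega), mul_zero, zero_sub,
      add_right_comm j 1, ← add_assoc, ← add_assoc, pow_succ]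
    split_ifs <;> simp

end Dem

open Dem in
/-- Let `D = ∂_{s_{n-1} ⋯ s_{i+1}}` (paper 1-based indexing)
and `0 ≤ i`, `2i < n`. Then
(1) `D(X_{i+1}^j · ∏_{r=1}^{i} (X_r - X_{i+1})) = 0` for `0 ≤ j < n - 2i - 1`;
(2) `D(X_{i+1}^{n-2i-1} · ∏_{r=1}^{i} (X_r - X_{i+1})) = (-1)^{n+1}`. -/
theorem statement19 (n : ℕ) (hn : 1 ≤ n) (i : ℕ) (h2i : 2 * i < n)
    (D : ℕ → R n → R n) (hD : IsDemFamily D) :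
    (∀ j : ℕ, j < n - 2 * i - 1 →
      applyWord D ((List.range (n - 1 - i)).reverse.map (· + i))
          (MvPolynomial.X (⟨i, by omega⟩ : Fin n) ^ j *
            ∏ r : Fin i,
              (MvPolynomial.X (Fin.castLE (by omega) r) -
                MvPolynomial.X (⟨i, by omega⟩ : Fin n)))
        = 0) ∧
    applyWord D ((List.range (n - 1 - i)).reverse.map (· + i))
        (MvPolynomial.X (⟨i, by omega⟩ : Fin n) ^ (n - 2 * i - 1) *
          ∏ r : Fin i,
            (MvPolynomial.X (Fin.castLE (by omega) r) -
              MvPolynomial.X (⟨i, by omega⟩ : Fin n)))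
      = MvPolynomial.C ((-1 : ℤ) ^ (n + 1)) := by
  obtain ⟨m, rfl⟩ : ∃ m, n = 2 * i + m + 1 := ⟨n - 2 * i - 1, by omega⟩
  rw [show 2 * i + m + 1 - 1 - i = i + m by omega, show 2 * i + m + 1 - 2 * i - 1 = m by omega]
  constructor
  · intro j hj
    have := hD.applyWord_X_pow_mul_prod i (i + m) (by omega) Finset.univ j
      (by rw [Finset.card_fin]; omega)
    rwa [Finset.card_fin, if_neg (by omega)] at this
  · have := hD.applyWord_X_pow_mul_prod i (i + m) (by omega) Finset.univ m
      (by rw [Finset.card_fin]; omega)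
    rw [Finset.card_fin, if_pos (by omega)] at this
    rw [show 2 * i + m + 1 + 1 = i + m + i + 2 by omega, pow_add _ _ 2, neg_one_sq, mul_one]
    exact this
end
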